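/- Let B be a symmetric n×n matrix with entries in [0,1], and let Σ be a random symmetric n×n matrix such that ‖Σ‖_∞ ≤ 1 almost surely, the entries (Σ_{ij})_{i<j} are independent and centered, and there exists α > 0 such that for every symmetric n×n matrix Θ, Σ_{i<j} E[Σ_{ij}²·Θ_{ij}²] ≤ α·‖Θ‖²_{2,B}. Let Θ̃ be a fixed symmetric n×n matrix with zero diagonal and entries in [0, ρ_n], and for T > 0 set S_B(T) = {Θ ∈ T_k : ‖Θ‖_∞ ≤ ρ_n, Θ_{ij} ≥ γ_n for all i < j, ‖Θ − Θ̃‖²_{2,B} ≤ T}. Then there exists an absolute constant C > 0 such that E[ sup_{Θ ∈ S_B(T)} | Σ_{i<j} Σ_{ij}·(Θ_{ij} − Θ̃_{ij}) | ] ≤ γ_n·α·T/(32·64²·ρ_n²) + C·(ρ_n²/γ_n)·(n·log k + k²). -/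

import Mathlib

open MeasureTheory ProbabilityTheory

noncomputable section

/-- Kullback–Leibler divergence between Bernoulli(q) and Bernoulli(q'). -/
def klBer (q q' : ℝ) : ℝ :=
  q * Real.log (q / q') + (1 - q) * Real.log ((1 - q) / (1 - q'))

/-- Sum of `f i j` over pairs `i < j`. -/
def pairSum {n : ℕ} (f : Fin n → Fin n → ℝ) : ℝ :=
  ∑ i : Fin n, ∑ j : Fin n, if i < j then f i j else 0

/-- Weighted squared norm `‖M‖_{2,B}² = Σ_{i<j} B_{ij} M_{ij}²`. -/
def wNormSq {n : ℕ} (B M : Fin n → Fin n → ℝ) : ℝ :=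
  pairSum fun i j => B i j * M i j ^ 2

/-- Weighted Kullback–Leibler divergence `K_B(M, M') = Σ_{i<j} B_{ij} K(M_{ij}, M'_{ij})`. -/
def wKL {n : ℕ} (B M M' : Fin n → Fin n → ℝ) : ℝ :=
  pairSum fun i j => B i j * klBer (M i j) (M' i j)

/-- Entrywise supremum norm `‖M‖_∞`. -/
def supNorm {n : ℕ} (M : Fin n → Fin n → ℝ) : ℝ :=
  ⨆ i, ⨆ j, |M i j|

/-- `M ∈ T_k`: symmetric block-constant matrix with zero diagonal, built from a symmetric
`k × k` matrix `Q` and a label function `z : [n] → [k]`. -/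
def IsBlockConst (n k : ℕ) (M : Fin n → Fin n → ℝ) : Prop :=
  (∀ i, M i i = 0) ∧
  ∃ (z : Fin n → Fin k) (Q : Fin k → Fin k → ℝ),
    (∀ a b, Q a b = Q b a) ∧ ∀ i j, i ≠ j → M i j = Q (z i) (z j)

/-- A symmetric zero-diagonal random matrix whose above-diagonal entries are independent
Bernoulli random variables, `A_{ij} ~ Bernoulli(P_{ij})` for `i < j`. -/
def IsBernoulliMatrix {Ω : Type} [MeasurableSpace Ω] (μ : Measure Ω) {n : ℕ}
    (A : Ω → Fin n → Fin n → ℝ) (P : Fin n → Fin n → ℝ) : Prop :=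
  (∀ i j, Measurable fun ω => A ω i j) ∧
  (∀ ω i j, A ω i j = A ω j i) ∧
  (∀ ω i, A ω i i = 0) ∧
  (∀ ω i j, A ω i j = 0 ∨ A ω i j = 1) ∧
  (∀ i j, i < j → μ {ω | A ω i j = 1} = ENNReal.ofReal (P i j)) ∧
  iIndepFun
    (fun (p : {p : Fin n × Fin n // p.1 < p.2}) ω => A ω p.1.1 p.1.2) μ


lemma pairSum_eq {n : ℕ} (f : Fin n → Fin n → ℝ) :
    pairSum f = ∑ p : {p : Fin n × Fin n // p.1 < p.2}, f p.1.1 p.1.2 := by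
  unfold pairSum
  rw [← Fintype.sum_prod_type' (f := fun i j => if i < j then f i j else 0)]
  rw [← Finset.sum_filter]
  exact Finset.sum_subtype _ (by simp) (fun x : Fin n × Fin n => f x.1 x.2)

lemma exp_int_bound {Ω P : Type} [MeasurableSpace Ω] [Fintype P] (μ : Measure Ω)
    [IsProbabilityMeasure μ] (X : P → Ω → ℝ) (hm : ∀ p, Measurable (X p))
    (hb : ∀ᵐ ω ∂μ, ∀ p, |X p ω| ≤ 1) (c : P → ℝ) :
    Integrable (fun ω => Real.exp (∑ p, c p * X p ω)) μ := by
  refine Integrable.of_bound (C := Real.exp (∑ p, |c p|)) ?_ ?_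
  · have : Measurable (fun ω => Real.exp (∑ p, c p * X p ω)) := by fun_prop
    exact this.aestronglyMeasurable
  · filter_upwards [hb] with ω hω
    rw [Real.norm_eq_abs, Real.abs_exp]
    apply Real.exp_le_exp.2
    apply Finset.sum_le_sum
    intro p _
    calc c p * X p ω ≤ |c p * X p ω| := le_abs_self _
      _ = |c p| * |X p ω| := abs_mul _ _
      _ ≤ |c p| * 1 := by gcongr; exact hω p
      _ = _ := mul_one _

lemma sq_int {Ω : Type} [MeasurableSpace Ω] (μ : Measure Ω)
    [IsProbabilityMeasure μ] (X : Ω → ℝ) (hm : Measurable X)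
    (hb : ∀ᵐ ω ∂μ, |X ω| ≤ 1) : Integrable (fun ω => X ω ^ 2) μ := by
  refine Integrable.of_bound (C := 1) (by fun_prop) ?_
  filter_upwards [hb] with ω hω
  rw [Real.norm_eq_abs, abs_pow]
  exact pow_le_one₀ (abs_nonneg _) hω

lemma mgf_one {Ω : Type} [MeasurableSpace Ω] (μ : Measure Ω)
    [IsProbabilityMeasure μ] (X : Ω → ℝ) (hm : Measurable X)
    (hb : ∀ᵐ ω ∂μ, |X ω| ≤ 1) (h0 : ∫ ω, X ω ∂μ = 0) (c : ℝ) (hc : |c| ≤ 1) :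
    ∫ ω, Real.exp (c * X ω) ∂μ ≤ Real.exp (c ^ 2 * ∫ ω, X ω ^ 2 ∂μ) := by
  have hX : Integrable X μ := Integrable.of_bound (C := 1) (by fun_prop) (by simpa using hb)
  have hX2 := sq_int μ X hm hb
  have h1 : ∫ ω, Real.exp (c * X ω) ∂μ ≤ ∫ ω, (1 + c * X ω + c ^ 2 * X ω ^ 2) ∂μ := by
    apply integral_mono_of_nonneg
    · exact Filter.Eventually.of_forall fun ω => (Real.exp_pos _).le
    · exact ((integrable_const _).add (hX.const_mul c)).add (hX2.const_mul _)
    · filter_upwards [hb] with ω hω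
      have : |c * X ω| ≤ 1 := by
        rw [abs_mul]; exact mul_le_one₀ hc (abs_nonneg _) hω
      have := abs_le.1 (Real.abs_exp_sub_one_sub_id_le this)
      have h2 := this.2
      rw [mul_pow] at h2
      linarith
  refine h1.trans ?_
  have hI : Integrable (fun ω => 1 + c * X ω) μ := (integrable_const _).add (hX.const_mul c)
  rw [integral_add hI (hX2.const_mul _),
    integral_add (integrable_const _) (hX.const_mul c), integral_const_mul, integral_const_mul, h0]
  simp only [integral_const, probReal_univ, smul_eq_mul, mul_one, mul_zero, add_zero]
  linarith [Real.add_one_le_exp (c ^ 2 * ∫ ω, X ω ^ 2 ∂μ)]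

lemma mgf_all {Ω P : Type} [MeasurableSpace Ω] [Fintype P] (μ : Measure Ω)
    [IsProbabilityMeasure μ] (X : P → Ω → ℝ) (hm : ∀ p, Measurable (X p))
    (hb : ∀ᵐ ω ∂μ, ∀ p, |X p ω| ≤ 1) (h0 : ∀ p, ∫ ω, X p ω ∂μ = 0)
    (hi : iIndepFun X μ) (c : P → ℝ) (hc : ∀ p, |c p| ≤ 1) :
    ∫ ω, Real.exp (∑ p, c p * X p ω) ∂μ ≤
      Real.exp (∑ p, c p ^ 2 * ∫ ω, X p ω ^ 2 ∂μ) := by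
  have hi2 : iIndepFun (fun p ω => Real.exp (c p * X p ω)) μ :=
    hi.comp (fun p x => Real.exp (c p * x)) (fun p => by fun_prop)
  simp_rw [Real.exp_sum]
  have := hi2.integral_fun_prod_eq_prod_integral (fun p => by have := hm p; fun_prop)
  rw [this]
  apply Finset.prod_le_prod
  · intro p _
    exact integral_nonneg fun ω => (Real.exp_pos _).le
  · intro p _
    exact mgf_one μ (X p) (hm p) (hb.mono fun ω h => h p) (h0 p) (c p) (hc p)

lemma block_grid (r V : ℝ) (hr : 0 < r) (hV : 0 ≤ V) :
    ∃ δ : ℝ, 0 < δ ∧ δ ≤ r ∧ δ ^ 2 * V ≤ 1 ∧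
      ∑ m ∈ Finset.Icc 1 ⌊r / δ⌋₊, Real.exp (-((m : ℝ) * δ) ^ 2 * V / 4) ≤ 5 := by
  by_cases h : r ^ 2 * V ≤ 1
  · refine ⟨r, hr, le_rfl, h, ?_⟩
    rw [div_self hr.ne']
    simp only [Nat.floor_one, Finset.Icc_self, Finset.sum_singleton]
    have : Real.exp (-(((1 : ℕ) : ℝ) * r) ^ 2 * V / 4) ≤ 1 := by
      apply Real.exp_le_one_iff.2
      have : 0 ≤ r ^ 2 * V := by positivity
      rw [Nat.cast_one, one_mul]
      linarith
    linarith
  · push Not at h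
    have hV0 : 0 < V := by
      rcases hV.eq_or_lt with h' | h'
      · rw [← h'] at h; simp at h; linarith
      · exact h'
    have hs : 0 < √V := Real.sqrt_pos.2 hV0
    have hd : (1 / √V) ^ 2 * V = 1 := by
      rw [div_pow, Real.sq_sqrt hV]; field_simp
    refine ⟨1 / √V, by positivity, ?_, hd.le, ?_⟩
    · refine le_of_sq_le_sq ?_ hr.le
      have : (1 / √V) ^ 2 * V ≤ r ^ 2 * V := by linarith
      exact le_of_mul_le_mul_right this hV0
    · calc _ ≤ ∑ m ∈ Finset.Icc 1 ⌊r / (1 / √V)⌋₊, ((4 : ℝ) / 5) ^ m := by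
            apply Finset.sum_le_sum
            intro m hm
            have hm1 : (1 : ℝ) ≤ m := by exact_mod_cast (Finset.mem_Icc.1 hm).1
            have e1 : -((m : ℝ) * (1 / √V)) ^ 2 * V / 4 = - (m : ℝ) ^ 2 / 4 := by
              have : -((m : ℝ) * (1 / √V)) ^ 2 * V / 4 = -(m : ℝ) ^ 2 * ((1 / √V) ^ 2 * V) / 4 := by
                ring
              rw [this, hd]; ring
            rw [e1]
            have e2 : Real.exp (-(1 / 4)) ≤ 4 / 5 := by
              rw [Real.exp_neg, inv_le_comm₀ (Real.exp_pos _) (by norm_num)]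
              have := Real.add_one_le_exp (1 / 4 : ℝ)
              norm_num at *
              linarith
            calc Real.exp (-(m : ℝ) ^ 2 / 4) ≤ Real.exp (m * (-(1 / 4))) := by
                  apply Real.exp_le_exp.2; nlinarith
              _ = Real.exp (-(1 / 4)) ^ m := Real.exp_nat_mul _ _
              _ ≤ _ := by gcongr
        _ ≤ ∑ m ∈ Finset.range (⌊r / (1 / √V)⌋₊ + 1), ((4 : ℝ) / 5) ^ m := by
            apply Finset.sum_le_sum_of_subset_of_nonneg
            · intro m hm
              simp at hm ⊢; omega
            · intros; positivity
        _ ≤ 5 := by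
            rw [geom_sum_eq (by norm_num)]
            have : (0 : ℝ) < (4 / 5) ^ (⌊r / (1 / √V)⌋₊ + 1) := by positivity
            rw [div_le_iff_of_neg (by norm_num)]
            linarith

def sg (b : Bool) : ℝ := if b then 1 else -1

lemma block_lemma (r V : ℝ) (hr : 0 < r) (hV : 0 ≤ V) :
    ∃ (F : Finset (ℕ × Bool)) (θ : ℕ × Bool → ℝ),
      (∀ q ∈ F, |θ q| ≤ r) ∧
      (∑ q ∈ F, Real.exp (-(θ q) ^ 2 * V / 4) ≤ 10) ∧
      ∀ S d : ℝ, |d| ≤ r → Real.exp ((S * d - d ^ 2 * V) / 4) ≤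
        ∑ q ∈ F, Real.exp 1 * Real.exp ((S * θ q - (θ q) ^ 2 * V) / 2) := by
  obtain ⟨δ, hδ, hδr, hδV, hsum⟩ := block_grid r V hr hV
  refine ⟨Finset.Icc 1 ⌊r / δ⌋₊ ×ˢ Finset.univ, fun q => sg q.2 * (q.1 * δ), ?_, ?_, ?_⟩
  · rintro ⟨m, b⟩ hq
    simp only [Finset.mem_product, Finset.mem_Icc, Finset.mem_univ, and_true] at hq
    have h1 : (m : ℝ) ≤ r / δ := (Nat.le_floor_iff (by positivity)).1 hq.2
    have h2 : (m : ℝ) * δ ≤ r := (le_div_iff₀ hδ).1 h1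
    have h3 : 0 ≤ (m : ℝ) * δ := by positivity
    have : |sg b| = 1 := by cases b <;> simp [sg]
    simp only [abs_mul, this, one_mul]
    rw [← abs_mul, abs_of_nonneg h3]; exact h2
  · rw [Finset.sum_product]
    simp only [Fintype.sum_bool, sg]
    simp only [if_true, Bool.false_eq_true, if_false, one_mul, neg_mul, neg_sq] at *
    rw [Finset.sum_add_distrib]
    linarith
  · intro S d hd
    -- reduce to a single term
    suffices h : ∃ q ∈ Finset.Icc 1 ⌊r / δ⌋₊ ×ˢ (Finset.univ : Finset Bool),
        (S * d - d ^ 2 * V) / 4 ≤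
          1 + (S * (sg q.2 * (q.1 * δ)) - (sg q.2 * (q.1 * δ)) ^ 2 * V) / 2 by
      obtain ⟨q, hq, hle⟩ := h
      refine le_trans ?_ (Finset.single_le_sum (f := fun q : ℕ × Bool =>
        Real.exp 1 * Real.exp ((S * (sg q.2 * (q.1 * δ)) - (sg q.2 * (q.1 * δ)) ^ 2 * V) / 2))
        (fun i _ => by positivity) hq)
      rw [← Real.exp_add]
      exact Real.exp_le_exp.2 hle
    have hone : 1 ≤ ⌊r / δ⌋₊ := by
      rw [Nat.one_le_floor_iff, le_div_iff₀ hδ]; linarith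
    by_cases hA : S * d - d ^ 2 * V ≤ |S| * δ
    · have h0 : 0 ≤ |S| * δ := by positivity
      rcases le_total 0 S with hS | hS
      · refine ⟨(1, true), by simpa using hone, ?_⟩
        rw [abs_of_nonneg hS] at hA h0
        simp only [sg, if_true, Nat.cast_one, one_mul]
        linarith
      · refine ⟨(1, false), by simpa using hone, ?_⟩
        rw [abs_of_nonpos hS] at hA h0
        simp only [sg, Bool.false_eq_true, if_false, Nat.cast_one, one_mul, neg_mul, neg_sq]
        linarith
    · push Not at hA
      have hSd : 0 < S * d - d ^ 2 * V := lt_of_le_of_lt (by positivity) hA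
      have hdd : δ < |d| := by
        by_contra hcon
        push Not at hcon
        have : S * d ≤ |S| * |d| := by rw [← abs_mul]; exact le_abs_self _
        have h2 : |S| * |d| ≤ |S| * δ := by gcongr
        have h3 : 0 ≤ d ^ 2 * V := by positivity
        linarith
      have hd0 : 0 < |d| := hδ.trans hdd
      set m := ⌊|d| / δ⌋₊ with hm
      have hm1 : 1 ≤ m := by
        rw [hm, Nat.one_le_floor_iff, le_div_iff₀ hδ]; linarith
      have hmr : m ≤ ⌊r / δ⌋₊ := Nat.floor_le_floor (by gcongr)
      have hml : (m : ℝ) * δ ≤ |d| := (le_div_iff₀ hδ).1 (Nat.floor_le (by positivity))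
      have hmu : |d| < ((m : ℝ) + 1) * δ := (div_lt_iff₀ hδ).1 (Nat.lt_floor_add_one _)
      have hm1' : (1 : ℝ) ≤ m := by exact_mod_cast hm1
      have hmd : δ ≤ m * δ := by nlinarith
      set τ := (m : ℝ) * δ / |d| with hτ
      have hτ1 : τ ≤ 1 := (div_le_one hd0).2 hml
      have hτ2 : 1 / 2 ≤ τ := by
        rw [hτ, le_div_iff₀ hd0]; linarith
      have key : ∀ b : Bool, sg b * |d| = d →
          (S * d - d ^ 2 * V) / 4 ≤ 1 + (S * (sg b * (m * δ)) - (sg b * (m * δ)) ^ 2 * V) / 2 := by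
        intro b hb
        have e : sg b * (m * δ) = τ * d := by
          rw [← hb, hτ, hb]
          field_simp
          rw [← hb]
          have : |sg b| = 1 := by cases b <;> simp [sg]
          simp [abs_mul, this]
        rw [e]
        have h1 : S * (τ * d) - (τ * d) ^ 2 * V ≥ τ * (S * d - d ^ 2 * V) := by
          have : 0 ≤ τ * (1 - τ) * (d ^ 2 * V) := by
            have : 0 ≤ 1 - τ := by linarith
            positivity
          nlinarith
        nlinarith
      rcases le_total 0 d with hs | hs
      · exact ⟨(m, true), by simpa using ⟨hm1, hmr⟩, key true (by simp [sg, abs_of_nonneg hs])⟩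
      · exact ⟨(m, false), by simpa using ⟨hm1, hmr⟩, key false (by simp [sg, abs_of_nonpos hs])⟩

lemma fiber_sum {P κ : Type} [Fintype P] [Fintype κ] [DecidableEq κ] (β : P → κ)
    (x : P → ℝ) (g : κ → ℝ) :
    ∑ p, x p * g (β p) = ∑ b, (∑ p with β p = b, x p) * g b := by
  rw [← Finset.sum_fiberwise (s := Finset.univ) (g := β)]
  refine Finset.sum_congr rfl fun b _ => ?_
  rw [Finset.sum_mul]
  refine Finset.sum_congr rfl fun p hp => ?_
  rw [(Finset.mem_filter.1 hp).2]

lemma block_max {Ω P κ : Type} [MeasurableSpace Ω] [Fintype P] [Fintype κ] (μ : Measure Ω)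
    [IsProbabilityMeasure μ] (X : P → Ω → ℝ) (hm : ∀ p, Measurable (X p))
    (hb : ∀ᵐ ω ∂μ, ∀ p, |X p ω| ≤ 1) (h0 : ∀ p, ∫ ω, X p ω ∂μ = 0)
    (hi : iIndepFun X μ) (β : P → κ) (r : ℝ) (hr : 0 < r) (hr1 : r ≤ 1) :
    ∃ W : Ω → ℝ, Integrable W μ ∧ (∀ ω, 0 ≤ W ω) ∧
      ∫ ω, W ω ∂μ ≤ Real.exp (4 * Fintype.card κ) ∧
      ∀ ω, ∀ d : κ → ℝ, (∀ b, |d b| ≤ r) →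
        Real.exp ((∑ p, X p ω * d (β p) - ∑ p, (∫ ω, X p ω ^ 2 ∂μ) * d (β p) ^ 2) / 4) ≤ W ω := by
  classical
  set v : P → ℝ := fun p => ∫ ω, X p ω ^ 2 ∂μ with hv
  have hv0 : ∀ p, 0 ≤ v p := fun p => integral_nonneg fun ω => sq_nonneg _
  set V : κ → ℝ := fun b => ∑ p with β p = b, v p with hVd
  have hV0 : ∀ b, 0 ≤ V b := fun b => Finset.sum_nonneg fun p _ => hv0 p
  choose F θ hθ hsum hmain using fun b => block_lemma r (V b) hr (hV0 b)
  set S : κ → Ω → ℝ := fun b ω => ∑ p with β p = b, X p ω with hS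
  have hterm : ∀ (ω : Ω) (q : κ → ℕ × Bool),
      ∏ b, (Real.exp 1 * Real.exp ((S b ω * θ b (q b) - (θ b (q b)) ^ 2 * V b) / 2)) =
      Real.exp (Fintype.card κ) * Real.exp (- ∑ b, (θ b (q b)) ^ 2 * V b / 2) *
        Real.exp (∑ p, (θ (β p) (q (β p)) / 2) * X p ω) := by
    intro ω q
    have e1 : ∑ p, (θ (β p) (q (β p)) / 2) * X p ω = ∑ b, S b ω * (θ b (q b) / 2) := by
      rw [← fiber_sum β (fun p => X p ω) (fun b => θ b (q b) / 2)]
      exact Finset.sum_congr rfl fun p _ => mul_comm _ _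
    rw [Finset.prod_mul_distrib, ← Real.exp_sum, ← Real.exp_sum, e1, mul_assoc]
    congr 1
    · simp
    · rw [← Real.exp_add, ← Finset.sum_neg_distrib, ← Finset.sum_add_distrib]
      congr 1
      exact Finset.sum_congr rfl fun b _ => by ring
  have hint : ∀ q : κ → ℕ × Bool, Integrable (fun ω =>
      ∏ b, (Real.exp 1 * Real.exp ((S b ω * θ b (q b) - (θ b (q b)) ^ 2 * V b) / 2))) μ := by
    intro q
    simp_rw [hterm]
    exact (exp_int_bound μ X hm hb _).const_mul _
  refine ⟨fun ω => ∏ b, ∑ q ∈ F b,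
    Real.exp 1 * Real.exp ((S b ω * θ b q - (θ b q) ^ 2 * V b) / 2), ?_, ?_, ?_, ?_⟩
  · simp_rw [Finset.prod_univ_sum]
    exact integrable_finsetSum _ fun q _ => hint q
  · intro ω
    exact Finset.prod_nonneg fun b _ => Finset.sum_nonneg fun q _ =>
      (mul_pos (Real.exp_pos _) (Real.exp_pos _)).le
  · simp_rw [Finset.prod_univ_sum]
    rw [integral_finsetSum _ fun q _ => hint q]
    calc _ ≤ ∑ q ∈ Fintype.piFinset F, ∏ b, (Real.exp 1 * Real.exp (-(θ b (q b)) ^ 2 * V b / 4)) := by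
          apply Finset.sum_le_sum
          intro q hq
          simp_rw [hterm]
          rw [integral_const_mul]
          have hq' : ∀ b, |θ b (q b)| ≤ r := fun b => hθ b _ (Fintype.mem_piFinset.1 hq b)
          have := mgf_all μ X hm hb h0 hi (fun p => θ (β p) (q (β p)) / 2) (fun p => by
            rw [abs_div]; have := hq' (β p); norm_num; linarith)
          refine (mul_le_mul_of_nonneg_left this (by positivity)).trans ?_
          rw [Finset.prod_mul_distrib, ← Real.exp_sum, ← Real.exp_sum, mul_assoc]
          have e2 : ∑ p, (θ (β p) (q (β p)) / 2) ^ 2 * ∫ ω, X p ω ^ 2 ∂μ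
              = ∑ b, V b * (θ b (q b) / 2) ^ 2 := by
            rw [← fiber_sum β v (fun b => (θ b (q b) / 2) ^ 2)]
            exact Finset.sum_congr rfl fun p _ => mul_comm _ _
          rw [e2]
          apply le_of_eq
          congr 1
          · simp
          · rw [← Real.exp_add, ← Finset.sum_neg_distrib, ← Finset.sum_add_distrib]
            congr 1
            exact Finset.sum_congr rfl fun b _ => by ring
      _ = ∏ b, ∑ q ∈ F b, Real.exp 1 * Real.exp (-(θ b q) ^ 2 * V b / 4) := by
          rw [Finset.prod_univ_sum]
      _ ≤ ∏ b : κ, Real.exp 4 := by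
          apply Finset.prod_le_prod
          · intro b _
            exact Finset.sum_nonneg fun q _ => (mul_pos (Real.exp_pos _) (Real.exp_pos _)).le
          · intro b _
            rw [← Finset.mul_sum]
            have h3 : (10 : ℝ) ≤ Real.exp 3 := by
              have h1 := Real.exp_one_gt_d9
              have : Real.exp 3 = Real.exp 1 ^ 3 := by
                rw [← Real.exp_nat_mul]; norm_num
              rw [this]
              calc (10 : ℝ) ≤ 2.7 ^ 3 := by norm_num
                _ ≤ _ := by gcongr; linarith
            calc _ ≤ Real.exp 1 * Real.exp 3 := by
                  gcongr; exact (hsum b).trans h3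
              _ = _ := by rw [← Real.exp_add]; norm_num
      _ = _ := by
          rw [Finset.prod_const, ← Real.exp_nat_mul, Finset.card_univ]; ring_nf
  · intro ω d hd
    have e1 := fiber_sum β (fun p => X p ω) d
    have e2 := fiber_sum β v (fun b => d b ^ 2)
    have : (∑ p, X p ω * d (β p) - ∑ p, v p * d (β p) ^ 2) / 4
        = ∑ b, (S b ω * d b - d b ^ 2 * V b) / 4 := by
      rw [e1, e2, ← Finset.sum_sub_distrib, Finset.sum_div]
      exact Finset.sum_congr rfl fun b _ => by ring
    rw [this, Real.exp_sum]
    apply Finset.prod_le_prod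
    · intro b _
      exact (Real.exp_pos _).le
    · intro b _
      exact hmain b (S b ω) (d b) (hd b)

lemma core {Ω P κ Z : Type} [MeasurableSpace Ω] [Fintype P] [Fintype κ] [Fintype Z] [Nonempty Z]
    (μ : Measure Ω)
    [IsProbabilityMeasure μ] (X : P → Ω → ℝ) (hm : ∀ p, Measurable (X p))
    (hb : ∀ᵐ ω ∂μ, ∀ p, |X p ω| ≤ 1) (h0 : ∀ p, ∫ ω, X p ω ∂μ = 0)
    (hi : iIndepFun X μ) (β : Z → P → κ) (ε ρ t : ℝ) (hε : 0 < ε) (hρ : 0 < ρ)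
    (hερ : ε * ρ ≤ 1) (ht : 0 ≤ t) (A : Z → P → ℝ) (hA : ∀ z p, |A z p| ≤ ρ)
    (hA2 : ∀ z, ∑ p, (∫ ω, X p ω ^ 2 ∂μ) * A z p ^ 2 ≤ t) :
    ∃ G : Ω → ℝ, Integrable G μ ∧ (∀ ω, 0 ≤ G ω) ∧
      ∫ ω, G ω ∂μ ≤ 5 * ε * t +
        (1 / ε) * (5 * Real.log (Fintype.card Z) + 16 * Fintype.card κ + 6) ∧
      ∀ ω, ∀ z, ∀ d : κ → ℝ, (∀ b, |d b| ≤ ρ) →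
        ∑ p, (∫ ω, X p ω ^ 2 ∂μ) * d (β z p) ^ 2 ≤ 4 * t →
        |∑ p, X p ω * (A z p + d (β z p))| ≤ G ω := by
  classical
  choose W hWi hW0 hWb hWm using fun z =>
    block_max μ X hm hb h0 hi (β z) (ε * ρ) (by positivity) hερ
  set K : ℝ := ((Fintype.card Z : ℕ) : ℝ) with hK
  have hK1 : 1 ≤ K := by
    rw [hK]; exact_mod_cast Fintype.card_pos
  have hK0 : 0 < K := by linarith
  have hlog : 0 ≤ Real.log K := Real.log_nonneg hK1
  set L1 : ℝ := Real.log K + 1 with hL1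
  set L2 : ℝ := Real.log K + 4 * Fintype.card κ with hL2
  set c : Z → P → ℝ := fun z p => ε * A z p with hc
  have hc1 : ∀ z p, |c z p| ≤ 1 := by
    intro z p
    rw [hc]; simp only [abs_mul, abs_of_pos hε]
    exact (mul_le_mul_of_nonneg_left (hA z p) hε.le).trans hερ
  have hc2 : ∀ z, ∑ p, c z p ^ 2 * ∫ ω, X p ω ^ 2 ∂μ ≤ ε ^ 2 * t := by
    intro z
    have : ∑ p, c z p ^ 2 * ∫ ω, X p ω ^ 2 ∂μ
        = ε ^ 2 * ∑ p, (∫ ω, X p ω ^ 2 ∂μ) * A z p ^ 2 := by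
      rw [Finset.mul_sum]; exact Finset.sum_congr rfl fun p _ => by rw [hc]; ring
    rw [this]; exact mul_le_mul_of_nonneg_left (hA2 z) (by positivity)
  set U : Z → Ω → ℝ := fun z ω => Real.exp (-(ε ^ 2 * t)) *
    (Real.exp (∑ p, c z p * X p ω) + Real.exp (∑ p, -c z p * X p ω)) with hU
  have hUi : ∀ z, Integrable (U z) μ := fun z =>
    ((exp_int_bound μ X hm hb _).add (exp_int_bound μ X hm hb _)).const_mul _
  have hU0 : ∀ z ω, 0 ≤ U z ω := fun z ω => by rw [hU]; positivity
  have hUb : ∀ z, ∫ ω, U z ω ∂μ ≤ Real.exp 1 := by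
    intro z
    rw [hU]; simp only
    rw [integral_const_mul, integral_add (exp_int_bound μ X hm hb _) (exp_int_bound μ X hm hb _)]
    have i1 := mgf_all μ X hm hb h0 hi (c z) (hc1 z)
    have i2 := mgf_all μ X hm hb h0 hi (fun p => -c z p) (fun p => by rw [abs_neg]; exact hc1 z p)
    simp only [neg_sq] at i2
    have i3 := Real.exp_le_exp.2 (hc2 z)
    calc _ ≤ Real.exp (-(ε ^ 2 * t)) * (Real.exp (ε ^ 2 * t) + Real.exp (ε ^ 2 * t)) := by
          gcongr
          · exact i1.trans i3
          · exact i2.trans i3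
      _ = 2 := by rw [← two_mul, mul_left_comm, ← Real.exp_add]; simp
      _ ≤ _ := by linarith [Real.add_one_le_exp (1 : ℝ)]
  have hsumK : ∀ (f : Z → Ω → ℝ) (L : ℝ), (∀ z, Integrable (f z) μ) →
      (∀ z, ∫ ω, f z ω ∂μ ≤ Real.exp L) →
      ∫ ω, Real.exp (-(Real.log K + L)) * ∑ z, f z ω ∂μ ≤ 1 := by
    intro f L hf hfb
    rw [integral_const_mul, integral_finsetSum _ fun z _ => hf z]
    calc _ ≤ Real.exp (-(Real.log K + L)) * ∑ z : Z, Real.exp L := by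
          gcongr with z _
          exact hfb z
      _ = 1 := by
          rw [Finset.sum_const, Finset.card_univ, nsmul_eq_mul, ← hK, neg_add, Real.exp_add,
            Real.exp_neg, Real.exp_log hK0, Real.exp_neg]
          field_simp
  have hIU : Integrable (fun ω => Real.exp (-L1) * ∑ z, U z ω) μ :=
    (integrable_finsetSum _ fun z _ => hUi z).const_mul _
  have hIW : Integrable (fun ω => Real.exp (-L2) * ∑ z, W z ω) μ :=
    (integrable_finsetSum _ fun z _ => hWi z).const_mul _
  have b1 := hsumK U 1 hUi hUb
  have b2 := hsumK W _ hWi hWb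
  rw [← hL1] at b1
  rw [← hL2] at b2
  have hL1' : 0 ≤ L1 := by positivity
  have hL2' : 0 ≤ L2 := by positivity
  have hU0' : ∀ ω, 0 ≤ Real.exp (-L1) * ∑ z, U z ω := fun ω =>
    mul_nonneg (Real.exp_pos _).le (Finset.sum_nonneg fun z _ => hU0 z ω)
  have hW0' : ∀ ω, 0 ≤ Real.exp (-L2) * ∑ z, W z ω := fun ω =>
    mul_nonneg (Real.exp_pos _).le (Finset.sum_nonneg fun z _ => hW0 z ω)
  have hlin : ∀ (y L w : ℝ) , Real.exp y ≤ w → y ≤ L + Real.exp (-L) * w := by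
    intro y L w h
    have h1 := Real.add_one_le_exp (y - L)
    have h2 : Real.exp (y - L) ≤ Real.exp (-L) * w := by
      rw [sub_eq_add_neg, Real.exp_add, mul_comm]; gcongr
    linarith
  refine ⟨fun ω => (5 * ε * t + (1 / ε) * (L1 + 4 * L2)) +
    ((1 / ε) * (Real.exp (-L1) * ∑ z, U z ω) + (4 / ε) * (Real.exp (-L2) * ∑ z, W z ω)),
    ?_, ?_, ?_, ?_⟩
  · exact (integrable_const _).add ((hIU.const_mul _).add (hIW.const_mul _))
  · intro ω
    have := hU0' ω
    have := hW0' ω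
    positivity
  · have hI2 : Integrable (fun ω => (1 / ε) * (Real.exp (-L1) * ∑ z, U z ω) +
        (4 / ε) * (Real.exp (-L2) * ∑ z, W z ω)) μ := (hIU.const_mul _).add (hIW.const_mul _)
    rw [integral_add (integrable_const _) hI2, integral_add (hIU.const_mul _) (hIW.const_mul _),
      integral_const_mul (1 / ε), integral_const_mul (4 / ε)]
    simp only [integral_const, probReal_univ, smul_eq_mul, one_mul]
    have j1 := mul_le_mul_of_nonneg_left b1 (show 0 ≤ 1 / ε by positivity)
    have j2 := mul_le_mul_of_nonneg_left b2 (show 0 ≤ 4 / ε by positivity)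
    have : 5 * ε * t + 1 / ε * (5 * Real.log K + 16 * (Fintype.card κ : ℝ) + 6) =
      5 * ε * t + 1 / ε * (L1 + 4 * L2) + (1 / ε * 1 + 4 / ε * 1) := by
      rw [hL1, hL2]; ring
    rw [this]
    linarith
  · intro ω z d hd hd2
    have e0 : ∑ p, X p ω * (A z p + d (β z p)) =
        ∑ p, X p ω * A z p + ∑ p, X p ω * d (β z p) := by
      rw [← Finset.sum_add_distrib]; exact Finset.sum_congr rfl fun p _ => by ring
    -- first part
    have k1 : ε * |∑ p, X p ω * A z p| - ε ^ 2 * t ≤ L1 + Real.exp (-L1) * ∑ z, U z ω := by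
      apply hlin
      refine le_trans ?_ (Finset.single_le_sum (f := fun z => U z ω) (fun i _ => hU0 i ω)
        (Finset.mem_univ z))
      have e1 : ∑ p, c z p * X p ω = ε * ∑ p, X p ω * A z p := by
        rw [Finset.mul_sum]; exact Finset.sum_congr rfl fun p _ => by rw [hc]; ring
      have e2 : ∑ p, -c z p * X p ω = -(ε * ∑ p, X p ω * A z p) := by
        rw [← e1, ← Finset.sum_neg_distrib]; exact Finset.sum_congr rfl fun p _ => by ring
      rw [hU]; simp only
      rw [e1, e2, sub_eq_add_neg, Real.exp_add, mul_comm (Real.exp _)]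
      gcongr
      rcases abs_cases (∑ p, X p ω * A z p) with ⟨h, _⟩ | ⟨h, _⟩ <;> rw [h]
      · linarith [Real.exp_pos (-(ε * ∑ p, X p ω * A z p))]
      · rw [mul_neg]; linarith [Real.exp_pos (ε * ∑ p, X p ω * A z p)]
    have k2' : ∀ s : ℝ, |s| = 1 → (ε * (s * ∑ p, X p ω * d (β z p)) - ε ^ 2 * (4 * t)) / 4 ≤
        L2 + Real.exp (-L2) * ∑ z, W z ω := by
      intro s hs
      apply hlin
      refine le_trans ?_ (Finset.single_le_sum (f := fun z => W z ω) (fun i _ => hW0 i ω)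
        (Finset.mem_univ z))
      refine le_trans ?_ (hWm z ω (fun b => ε * s * d b) (fun b => by
        rw [abs_mul, abs_mul, hs, abs_of_pos hε, mul_one]; gcongr; exact hd b))
      apply Real.exp_le_exp.2
      have hs2 : s ^ 2 = 1 := by rw [← sq_abs, hs]; norm_num
      have e1 : ∑ p, X p ω * (ε * s * d (β z p)) = ε * (s * ∑ p, X p ω * d (β z p)) := by
        rw [Finset.mul_sum, Finset.mul_sum]; exact Finset.sum_congr rfl fun p _ => by ring
      have e2 : ∑ p, (∫ ω, X p ω ^ 2 ∂μ) * (ε * s * d (β z p)) ^ 2 =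
          ε ^ 2 * ∑ p, (∫ ω, X p ω ^ 2 ∂μ) * d (β z p) ^ 2 := by
        rw [Finset.mul_sum]
        exact Finset.sum_congr rfl fun p _ => by rw [mul_pow, mul_pow, hs2]; ring
      simp only [e1, e2]
      have := mul_le_mul_of_nonneg_left hd2 (show 0 ≤ ε ^ 2 by positivity)
      linarith
    have k2 : ε * |∑ p, X p ω * d (β z p)| - ε ^ 2 * (4 * t) ≤
        4 * (L2 + Real.exp (-L2) * ∑ z, W z ω) := by
      rcases abs_cases (∑ p, X p ω * d (β z p)) with ⟨h, _⟩ | ⟨h, _⟩ <;> rw [h]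
      · have := k2' 1 (by simp); rw [one_mul] at this; linarith
      · have := k2' (-1) (by simp); rw [neg_one_mul] at this; linarith
    have k3 := abs_add_le (∑ p, X p ω * A z p) (∑ p, X p ω * d (β z p))
    rw [e0]
    refine le_of_mul_le_mul_left ?_ hε
    have e3 : ε * ((5 * ε * t + (1 / ε) * (L1 + 4 * L2)) +
      ((1 / ε) * (Real.exp (-L1) * ∑ z, U z ω) + (4 / ε) * (Real.exp (-L2) * ∑ z, W z ω))) =
      5 * ε ^ 2 * t + (L1 + 4 * L2) + (Real.exp (-L1) * ∑ z, U z ω)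
        + 4 * (Real.exp (-L2) * ∑ z, W z ω) := by
      field_simp
      try ring
    simp only [e3]
    have := mul_le_mul_of_nonneg_left k3 hε.le
    linarith

theorem stmt_16 :
    ∃ C : ℝ, 0 < C ∧
      ∀ (n : ℕ), 2 ≤ n → ∀ (k : ℕ), 1 ≤ k →
      ∀ (γ ρ : ℝ), 0 < γ → γ ≤ ρ → ρ < 1 →
      ∀ (Ω : Type) [MeasurableSpace Ω] (μ : Measure Ω), IsProbabilityMeasure μ →
      ∀ (B Θtil : Fin n → Fin n → ℝ) (Sig : Ω → Fin n → Fin n → ℝ) (α : ℝ),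
        0 < α →
        -- B symmetric with entries in [0,1]
        (∀ i j, B i j = B j i) → (∀ i j, B i j ∈ Set.Icc (0 : ℝ) 1) →
        -- Σ : random symmetric matrix, ‖Σ‖_∞ ≤ 1 a.s., centered independent entries
        (∀ i j, Measurable fun ω => Sig ω i j) →
        (∀ ω i j, Sig ω i j = Sig ω j i) →
        (∀ᵐ ω ∂μ, ∀ i j, |Sig ω i j| ≤ 1) →
        (∀ i j : Fin n, i < j → Integrable (fun ω => Sig ω i j) μ) →
        (∀ i j : Fin n, i < j → (∫ ω, Sig ω i j ∂μ) = 0) →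
        iIndepFun
          (fun (p : {p : Fin n × Fin n // p.1 < p.2}) ω => Sig ω p.1.1 p.1.2) μ →
        -- second-moment domination: Σ_{i<j} E[Σ_{ij}² Θ_{ij}²] ≤ α ‖Θ‖²_{2,B}
        (∀ Θ : Fin n → Fin n → ℝ, (∀ i j, Θ i j = Θ j i) →
          pairSum (fun i j => ∫ ω, Sig ω i j ^ 2 * Θ i j ^ 2 ∂μ) ≤ α * wNormSq B Θ) →
        -- Θ̃ symmetric, zero diagonal, entries in [0, ρ]
        (∀ i j, Θtil i j = Θtil j i) → (∀ i, Θtil i i = 0) →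
        (∀ i j, Θtil i j ∈ Set.Icc (0 : ℝ) ρ) →
        ∀ T : ℝ, 0 < T →
          (∫ ω, (⨆ Θ : {Θ : Fin n → Fin n → ℝ // IsBlockConst n k Θ ∧ supNorm Θ ≤ ρ ∧
              (∀ i j : Fin n, i < j → γ ≤ Θ i j) ∧
              wNormSq B (fun i j => Θ i j - Θtil i j) ≤ T},
            |pairSum (fun i j => Sig ω i j * (Θ.1 i j - Θtil i j))|) ∂μ) ≤
            γ * α * T / (32 * 64 ^ 2 * ρ ^ 2) +
              C * (ρ ^ 2 / γ) * (n * Real.log k + (k : ℝ) ^ 2) := by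
  refine ⟨655360 * 22, by norm_num, ?_⟩
  intro n hn k hk γ ρ hγ hγρ hρ1 Ω _ μ hμ B Θt Sig α hα hBs hB hmeas hsym hbd hint hcent hindep
    hvar hts htd htb T hT
  have hρ : 0 < ρ := hγ.trans_le hγρ
  set X : {p : Fin n × Fin n // p.1 < p.2} → Ω → ℝ := fun p ω => Sig ω p.1.1 p.1.2 with hX
  have hXb : ∀ᵐ ω ∂μ, ∀ p, |X p ω| ≤ 1 := hbd.mono fun ω h p => h _ _
  have hv0 : ∀ p, 0 ≤ ∫ ω, X p ω ^ 2 ∂μ := fun p => integral_nonneg fun ω => sq_nonneg _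
  set S : (Fin n → Fin n → ℝ) → Prop := fun Θ => IsBlockConst n k Θ ∧ supNorm Θ ≤ ρ ∧
              (∀ i j : Fin n, i < j → γ ≤ Θ i j) ∧
              wNormSq B (fun i j => Θ i j - Θt i j) ≤ T with hS
  set β : (Fin n → Fin k) → {p : Fin n × Fin n // p.1 < p.2} → Fin k × Fin k :=
    fun z p => (z p.1.1, z p.1.2) with hβ
  have hsym' : ∀ Θ, S Θ → ∀ i j, Θ i j = Θ j i := by
    rintro Θ ⟨⟨_, z, Q, hQ, hz⟩, _⟩ i j
    by_cases hij : i = j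
    · rw [hij]
    · rw [hz i j hij, hz j i (Ne.symm hij), hQ]
  have hle : ∀ Θ, S Θ → ∀ i j, Θ i j ≤ ρ := by
    rintro Θ ⟨_, h, _⟩ i j
    refine le_trans ?_ h
    refine (le_abs_self _).trans ?_
    unfold supNorm
    exact (le_ciSup (f := fun j => |Θ i j|) (Set.finite_range _).bddAbove j).trans
      (le_ciSup (f := fun i => ⨆ j, |Θ i j|) (Set.finite_range _).bddAbove i)
  have hvS : ∀ Θ, S Θ → ∑ p : {p : Fin n × Fin n // p.1 < p.2}, (∫ ω, X p ω ^ 2 ∂μ) *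
      (Θ p.1.1 p.1.2 - Θt p.1.1 p.1.2) ^ 2 ≤ α * T := by
    intro Θ hΘ
    have h1 := hvar (fun i j => Θ i j - Θt i j) (fun i j => by rw [hsym' Θ hΘ i j, hts i j])
    rw [pairSum_eq] at h1
    simp_rw [integral_mul_const] at h1
    exact h1.trans (mul_le_mul_of_nonneg_left hΘ.2.2.2 hα.le)
  have hdec : ∀ z : Fin n → Fin k, ∃ A : {p : Fin n × Fin n // p.1 < p.2} → ℝ,
      (∀ p, |A p| ≤ ρ) ∧ ∑ p, (∫ ω, X p ω ^ 2 ∂μ) * A p ^ 2 ≤ α * T ∧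
      ∀ Θ, S Θ → ∀ Q : Fin k → Fin k → ℝ, (∀ i j, i ≠ j → Θ i j = Q (z i) (z j)) →
        ∃ d : Fin k × Fin k → ℝ, (∀ b, |d b| ≤ ρ) ∧
          ∑ p, (∫ ω, X p ω ^ 2 ∂μ) * d (β z p) ^ 2 ≤ 4 * (α * T) ∧
          ∀ p : {p : Fin n × Fin n // p.1 < p.2},
            Θ p.1.1 p.1.2 - Θt p.1.1 p.1.2 = A p + d (β z p) := by
    classical
    intro z
    by_cases hex : ∃ Θ0, S Θ0 ∧ ∃ Q : Fin k → Fin k → ℝ, ∀ i j, i ≠ j → Θ0 i j = Q (z i) (z j)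
    · obtain ⟨Θ0, hΘ0, Q0, hQ0⟩ := hex
      refine ⟨fun p => Θ0 p.1.1 p.1.2 - Θt p.1.1 p.1.2, ?_, hvS Θ0 hΘ0, ?_⟩
      · intro p
        have h1 := hle Θ0 hΘ0 p.1.1 p.1.2
        have h2 := hΘ0.2.2.1 _ _ p.2
        have h3 := htb p.1.1 p.1.2
        rw [abs_le]; constructor <;> linarith [h3.1, h3.2]
      · intro Θ hΘ Q hQ
        set d : Fin k × Fin k → ℝ := fun b =>
          if ∃ p, β z p = b then Q b.1 b.2 - Q0 b.1 b.2 else 0 with hd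
        have hdp : ∀ p : {p : Fin n × Fin n // p.1 < p.2},
            d (β z p) = Θ p.1.1 p.1.2 - Θ0 p.1.1 p.1.2 := by
          intro p
          rw [hd]; simp only
          rw [if_pos ⟨p, rfl⟩, hQ _ _ p.2.ne, hQ0 _ _ p.2.ne]
        refine ⟨d, ?_, ?_, ?_⟩
        · intro b
          by_cases hbp : ∃ p, β z p = b
          · obtain ⟨p, rfl⟩ := hbp
            rw [hdp]
            have h1 := hle Θ0 hΘ0 p.1.1 p.1.2
            have h2 := hΘ0.2.2.1 _ _ p.2
            have h3 := hle Θ hΘ p.1.1 p.1.2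
            have h4 := hΘ.2.2.1 _ _ p.2
            rw [abs_le]; constructor <;> linarith
          · rw [hd]; simp only [if_neg hbp, abs_zero]; exact hρ.le
        · have h1 := hvS Θ hΘ
          have h2 := hvS Θ0 hΘ0
          calc _ ≤ ∑ p : {p : Fin n × Fin n // p.1 < p.2},
                (2 * ((∫ ω, X p ω ^ 2 ∂μ) * (Θ p.1.1 p.1.2 - Θt p.1.1 p.1.2) ^ 2) +
                2 * ((∫ ω, X p ω ^ 2 ∂μ) * (Θ0 p.1.1 p.1.2 - Θt p.1.1 p.1.2) ^ 2)) := by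
                apply Finset.sum_le_sum
                intro p _
                rw [hdp]
                have : (Θ p.1.1 p.1.2 - Θ0 p.1.1 p.1.2) ^ 2 ≤
                  2 * (Θ p.1.1 p.1.2 - Θt p.1.1 p.1.2) ^ 2 +
                  2 * (Θ0 p.1.1 p.1.2 - Θt p.1.1 p.1.2) ^ 2 := by
                  nlinarith [sq_nonneg ((Θ p.1.1 p.1.2 - Θt p.1.1 p.1.2) +
                    (Θ0 p.1.1 p.1.2 - Θt p.1.1 p.1.2))]
                have := mul_le_mul_of_nonneg_left this (hv0 p)
                linarith
            _ ≤ _ := by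
                rw [Finset.sum_add_distrib, ← Finset.mul_sum, ← Finset.mul_sum]
                linarith
        · intro p
          rw [hdp]; ring
    · refine ⟨fun _ => 0, by simp [hρ.le], ?_, ?_⟩
      · simp; positivity
      · intro Θ hΘ Q hQ
        exact absurd ⟨Θ, hΘ, Q, hQ⟩ hex
  choose A hA hA2 hAd using hdec
  set ε : ℝ := γ / (655360 * ρ ^ 2) with hε
  have hε0 : 0 < ε := by positivity
  have hερ : ε * ρ ≤ 1 := by
    rw [hε, div_mul_eq_mul_div, div_le_one (by positivity)]
    nlinarith
  haveI : Nonempty (Fin n → Fin k) := ⟨fun _ => ⟨0, hk⟩⟩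
  obtain ⟨G, hGi, hG0, hGb, hGm⟩ := core μ X (fun p => hmeas _ _) hXb
    (fun p => hcent _ _ p.2) hindep β ε ρ (α * T) hε0 hρ hερ (by positivity) A hA hA2
  have hmono : ∀ ω, (⨆ Θ : {Θ : Fin n → Fin n → ℝ // S Θ},
      |pairSum (fun i j => Sig ω i j * (Θ.1 i j - Θt i j))|) ≤ G ω := by
    intro ω
    refine Real.iSup_le ?_ (hG0 ω)
    rintro ⟨Θ, hΘ⟩
    obtain ⟨_, z, Q, _, hz⟩ := hΘ.1
    obtain ⟨d, hd1, hd2, hd3⟩ := hAd z Θ hΘ Q hz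
    have := hGm ω z d hd1 hd2
    rw [pairSum_eq]
    simp only [hd3]
    exact this
  have h1 : (∫ ω, (⨆ Θ : {Θ : Fin n → Fin n → ℝ // S Θ},
      |pairSum (fun i j => Sig ω i j * (Θ.1 i j - Θt i j))|) ∂μ) ≤ ∫ ω, G ω ∂μ :=
    integral_mono_of_nonneg
      (Filter.Eventually.of_forall fun ω => Real.iSup_nonneg fun _ => abs_nonneg _) hGi
      (Filter.Eventually.of_forall hmono)
  refine h1.trans (hGb.trans ?_)
  have hcard : Real.log (Fintype.card (Fin n → Fin k) : ℝ) = n * Real.log k := by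
    simp [Fintype.card_fun, Real.log_pow]
  have hcard2 : (Fintype.card (Fin k × Fin k) : ℝ) = (k : ℝ) ^ 2 := by
    simp [sq]
  rw [hcard, hcard2]
  have hk1 : (1 : ℝ) ≤ k := by exact_mod_cast hk
  have hk2 : (1 : ℝ) ≤ (k : ℝ) ^ 2 := one_le_pow₀ hk1
  have hnl : 0 ≤ (n : ℝ) * Real.log k := mul_nonneg (by positivity) (Real.log_nonneg hk1)
  have e1 : 5 * ε * (α * T) = γ * α * T / (32 * 64 ^ 2 * ρ ^ 2) := by
    rw [hε]; field_simp; norm_num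
  have e2 : 1 / ε = 655360 * (ρ ^ 2 / γ) := by
    rw [hε]; field_simp
  rw [e1, e2]
  have : 655360 * (ρ ^ 2 / γ) * (5 * (n * Real.log k) + 16 * (k : ℝ) ^ 2 + 6) ≤
      655360 * (ρ ^ 2 / γ) * (22 * (n * Real.log k + (k : ℝ) ^ 2)) :=
    mul_le_mul_of_nonneg_left (by linarith) (by positivity)
  linarith
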